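/- Let t ≥ 3 and n ≥ t+1, and let G* attain the maximum spectral radius ρ among all n-vertex connected K_{1,t}-minor free graphs. Let X be a positive eigenvector of the adjacency matrix of G* for ρ, and let u* be a vertex at which X attains its maximum entry. Then ρ > t − 2 and the degree of u* in G* equals t − 1. -/

import Mathlib

open SimpleGraph

/-- `H` is a minor of `G` (branch-set definition). -/
def MinorOf {α β : Type} (H : SimpleGraph α) (G : SimpleGraph β) : Prop :=
  ∃ φ : α → Set β,
    (∀ a, (G.induce (φ a)).Connected) ∧
    (Pairwise fun a b => Disjoint (φ a) (φ b)) ∧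
    (∀ a b, H.Adj a b → ∃ x ∈ φ a, ∃ y ∈ φ b, G.Adj x y)

/-- Adjacency matrix over ℝ. -/
noncomputable def adjMat {V : Type} [Fintype V] (G : SimpleGraph V) : Matrix V V ℝ :=
  letI := Classical.decRel G.Adj
  SimpleGraph.adjMatrix ℝ G

theorem adjMat_herm {V : Type} [Fintype V] (G : SimpleGraph V) : (adjMat G).IsHermitian := by
  letI := Classical.decRel G.Adj
  ext i j
  simp [adjMat, Matrix.conjTranspose_apply, SimpleGraph.adjMatrix_apply, SimpleGraph.adj_comm]

/-- Spectral radius = largest adjacency eigenvalue. -/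
noncomputable def specRad {V : Type} [Fintype V] [DecidableEq V] (G : SimpleGraph V) : ℝ :=
  ⨆ i, (adjMat_herm G).eigenvalues i

/-- degree -/
noncomputable def deg {V : Type} (G : SimpleGraph V) (v : V) : ℕ := (G.neighborSet v).ncard

/-- number of edges -/
noncomputable def ecard {V : Type} (G : SimpleGraph V) : ℕ := G.edgeSet.ncard

/-- k disjoint copies of G -/
def copies (k : ℕ) {V : Type} (G : SimpleGraph V) : SimpleGraph (Fin k × V) :=
  SimpleGraph.fromRel fun x y => x.1 = y.1 ∧ G.Adj x.2 y.2

/-- disjoint union -/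
def gUnion {V W : Type} (G : SimpleGraph V) (H : SimpleGraph W) : SimpleGraph (V ⊕ W) :=
  SimpleGraph.fromRel fun x y =>
    (∃ a b, x = Sum.inl a ∧ y = Sum.inl b ∧ G.Adj a b) ∨
    (∃ a b, x = Sum.inr a ∧ y = Sum.inr b ∧ H.Adj a b)

/-- join -/
def gJoin {V W : Type} (G : SimpleGraph V) (H : SimpleGraph W) : SimpleGraph (V ⊕ W) :=
  SimpleGraph.fromRel fun x y =>
    (∃ a b, x = Sum.inl a ∧ y = Sum.inl b ∧ G.Adj a b) ∨
    (∃ a b, x = Sum.inr a ∧ y = Sum.inr b ∧ H.Adj a b) ∨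
    (∃ a b, x = Sum.inl a ∧ y = Sum.inr b)

/-- Petersen graph (Kneser graph K(5,2)). -/
def petersen : SimpleGraph {s : Finset (Fin 5) // s.card = 2} :=
  SimpleGraph.fromRel fun a b => Disjoint a.1 b.1

/-- star K_{1,m} -/
def starG (m : ℕ) : SimpleGraph (Fin 1 ⊕ Fin m) := completeBipartiteGraph (Fin 1) (Fin m)

/-- the star forest H_{s,t} -/
def Hst (s t : ℕ) :
    SimpleGraph ((Fin ((t+1)/(s+1) - 1) × (Fin 1 ⊕ Fin s)) ⊕ (Fin 1 ⊕ Fin (t - ((t+1)/(s+1) - 1) * (s+1)))) :=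
  gUnion (copies ((t+1)/(s+1) - 1) (starG s)) (starG (t - ((t+1)/(s+1) - 1) * (s+1)))

/-- subdivide the edge uv of G by a path through k new vertices -/
def subdividePath {V : Type} (G : SimpleGraph V) (u v : V) (k : ℕ) : SimpleGraph (V ⊕ Fin k) :=
  SimpleGraph.fromRel fun x y =>
    (∃ a b, x = Sum.inl a ∧ y = Sum.inl b ∧ G.Adj a b ∧ ¬(a = u ∧ b = v) ∧ ¬(a = v ∧ b = u)) ∨
    (∃ i : Fin k, x = Sum.inl u ∧ y = Sum.inr i ∧ (i : ℕ) = 0) ∨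
    (∃ i j : Fin k, x = Sum.inr i ∧ y = Sum.inr j ∧ (j : ℕ) = (i : ℕ) + 1) ∨
    (∃ i : Fin k, x = Sum.inr i ∧ y = Sum.inl v ∧ (i : ℕ) = k - 1)

/-- (s,t)-property -/
def HasSTProp (s t : ℕ) {V : Type} (G : SimpleGraph V) : Prop :=
  ∀ a b : ℕ, 1 ≤ a → 1 ≤ b → a + b = t + 1 → a ≤ min s ((t+1)/2) →
    ¬ MinorOf (completeBipartiteGraph (Fin a) (Fin b)) G

/-- H_{a,b,c} -/
def Habc (a b c : ℕ) : SimpleGraph (Fin 3 ⊕ (Fin a ⊕ Fin b ⊕ Fin c)) :=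
  SimpleGraph.fromRel fun x y =>
    (x = Sum.inl 0 ∧ y = Sum.inl 1) ∨
    (x = Sum.inl 0 ∧ ∃ i : Fin a, y = Sum.inr (Sum.inl i)) ∨
    (x = Sum.inl 0 ∧ ∃ i : Fin b, y = Sum.inr (Sum.inr (Sum.inl i))) ∨
    (x = Sum.inl 1 ∧ ∃ i : Fin a, y = Sum.inr (Sum.inl i)) ∨
    (x = Sum.inl 1 ∧ ∃ i : Fin c, y = Sum.inr (Sum.inr (Sum.inr i))) ∨
    (x = Sum.inl 2 ∧ ∃ i : Fin b, y = Sum.inr (Sum.inr (Sum.inl i))) ∨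
    (x = Sum.inl 2 ∧ ∃ i : Fin c, y = Sum.inr (Sum.inr (Sum.inr i)))

noncomputable def edgeDegSum {V : Type} (G H : SimpleGraph V) : ℕ :=
  ∑ᶠ e ∈ G.edgeSet, Sym2.lift ⟨fun u v => deg H u + deg H v, fun u v => by dsimp; ring⟩ e

/-- kite graph: clique on `0..t-2` with a pendant path. -/
def kiteG (t n : ℕ) : SimpleGraph (Fin n) where
  Adj i j := (i.val < j.val ∧ (j.val + 2 ≤ t ∨ j.val = i.val + 1)) ∨
    (j.val < i.val ∧ (i.val + 2 ≤ t ∨ i.val = j.val + 1))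
  symm := ⟨by intro i j h; tauto⟩
  loopless := ⟨by intro i h; omega⟩

theorem kiteG_connected (t n : ℕ) (hn : 0 < n) : (kiteG t n).Connected := by
  have h0 : ∀ k (hk : k < n), (kiteG t n).Reachable ⟨0, hn⟩ ⟨k, hk⟩ := by
    intro k
    induction k with
    | zero => intro hk; exact Reachable.refl _
    | succ k ih =>
      intro hk
      refine (ih (by omega)).trans (Adj.reachable ?_)
      left
      simp
  haveI : Nonempty (Fin n) := ⟨⟨0, hn⟩⟩
  refine ⟨fun a b => ?_⟩
  exact (h0 a.1 a.2).symm.trans (h0 b.1 b.2)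

theorem kiteG_interval (t n : ℕ) (B : Set (Fin n)) (hB : ((kiteG t n).induce B).Connected)
    (a b c : Fin n) (ha : a ∈ B) (hb : b ∈ B) (hac : a < c) (hcb : c < b) (hc : t ≤ c.val + 2) :
    c ∈ B := by
  by_contra hcB
  obtain ⟨p⟩ := hB.preconnected ⟨a, ha⟩ ⟨b, hb⟩
  obtain ⟨d, -, h1, h2⟩ := p.exists_boundary_dart {x | x.1 < c} hac (by simp; exact hcb.le)
  have hadj := d.adj
  simp only [Set.mem_ofPred_eq, not_lt] at h1 h2
  have hne : d.snd.1 ≠ c := fun h => hcB (h ▸ d.snd.2)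
  have h3 : c < d.snd.1 := lt_of_le_of_ne h2 (Ne.symm hne)
  simp only [comap_adj, kiteG, Function.Embedding.subtype_apply] at hadj
  rw [Fin.lt_def] at h1 h3
  omega

theorem kiteG_free (t n : ℕ) (ht : 3 ≤ t) :
    ¬ MinorOf (completeBipartiteGraph (Fin 1) (Fin t)) (kiteG t n) := by
  rintro ⟨φ, hconn, hdisj, hadj⟩
  have hB := hconn (Sum.inl 0)
  have hint := kiteG_interval t n _ hB
  have hex : ∀ i : Fin t, ∃ y ∈ φ (Sum.inr i), ∃ x ∈ φ (Sum.inl 0), (kiteG t n).Adj x y := by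
    intro i
    obtain ⟨x, hx, y, hy, h⟩ := hadj (Sum.inl 0) (Sum.inr i) (by simp)
    exact ⟨y, hy, x, hx, h⟩
  choose y hy x hx hxy using hex
  have hyB : ∀ i, y i ∉ φ (Sum.inl 0) := fun i h =>
    Set.disjoint_left.1 (hdisj (show (Sum.inl 0 : Fin 1 ⊕ Fin t) ≠ Sum.inr i by simp)) h (hy i)
  have hinj : Function.Injective (fun i => (y i).val) := by
    intro i j hij
    by_contra hne
    have hij' : y i = y j := Fin.ext hij
    exact Set.disjoint_left.1
      (hdisj (show (Sum.inr i : Fin 1 ⊕ Fin t) ≠ Sum.inr j by simpa using hne)) (hy i) (hij' ▸ hy j)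
  obtain ⟨⟨b0, hb0⟩⟩ := hB.nonempty
  have hfin : (φ (Sum.inl 0)).Finite := Set.toFinite _
  obtain ⟨m, hm, hmax⟩ := Set.exists_max_image _ id hfin ⟨b0, hb0⟩
  obtain ⟨k, hk, hmin⟩ := Set.exists_min_image _ id hfin ⟨b0, hb0⟩
  simp only [id] at hmax hmin
  have key : ∀ S : Finset ℕ, (∀ i, (y i).val ∈ S) → t ≤ S.card := by
    intro S hS
    have := Finset.card_le_card_of_injOn (s := Finset.univ) (t := S) (fun i => (y i).val)
      (by intro i _; exact hS i) hinj.injOn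
    simpa using this
  by_cases hkt : k.val + 2 ≤ t
  · have h := key (insert (m.val + 1) ((Finset.range (t - 1)).erase k.val)) (by
      intro i
      simp only [Finset.mem_insert, Finset.mem_erase, Finset.mem_range]
      have hne : (y i).val ≠ k.val := fun h => hyB i (Fin.ext h ▸ hk)
      by_cases hy2 : (y i).val < t - 1
      · exact Or.inr ⟨hne, hy2⟩
      left
      have hnm : (y i).val ≠ m.val := fun h => hyB i (Fin.ext h ▸ hm)
      have h1 : ¬ (y i).val < m.val := fun h =>
        hyB i (hint k m (y i) hk hm (Fin.lt_def.2 (by omega)) h (by omega))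
      have h2 := Fin.le_def.1 (hmax _ (hx i))
      have h3 := hxy i
      simp only [kiteG] at h3
      omega)
    have h2 := Finset.card_insert_le (m.val + 1) ((Finset.range (t - 1)).erase k.val)
    rw [Finset.card_erase_of_mem (by simp; omega), Finset.card_range] at h2
    omega
  · have h := key {m.val + 1, k.val - 1} (by
      intro i
      simp only [Finset.mem_insert, Finset.mem_singleton]
      have hnm : (y i).val ≠ m.val := fun h => hyB i (Fin.ext h ▸ hm)
      have hne : (y i).val ≠ k.val := fun h => hyB i (Fin.ext h ▸ hk)
      have h1 : ¬ (k.val < (y i).val ∧ (y i).val < m.val) := fun h =>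
        hyB i (hint k m (y i) hk hm h.1 h.2 (by omega))
      have h2 := Fin.le_def.1 (hmax _ (hx i))
      have h4 := Fin.le_def.1 (hmin _ (hx i))
      have h3 := hxy i
      simp only [kiteG] at h3
      omega)
    have := Finset.card_le_two (a := m.val + 1) (b := k.val - 1)
    omega

open scoped Matrix in
theorem rayleigh_le {V : Type} [Fintype V] [DecidableEq V] (G : SimpleGraph V) (x : V → ℝ) :
    ∑ i, ∑ j, x i * adjMat G i j * x j ≤ specRad G * ∑ i, x i ^ 2 := by
  have hA := adjMat_herm G
  set U : Matrix V V ℝ := (hA.eigenvectorUnitary : Matrix V V ℝ) with hU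
  have hspec : adjMat G = U * Matrix.diagonal hA.eigenvalues * Uᵀ := by
    have := hA.spectral_theorem
    simpa [Unitary.conjStarAlgAut_apply, Matrix.star_eq_conjTranspose, Function.comp_def] using this
  have hUU : U * Uᵀ = 1 := by
    have := Unitary.mul_star_self_of_mem hA.eigenvectorUnitary.2
    simpa [Matrix.star_eq_conjTranspose] using this
  have hle : ∀ i, hA.eigenvalues i ≤ specRad G := fun i =>
    le_ciSup (f := hA.eigenvalues) (Set.finite_range _).bddAbove i
  set y := Uᵀ.mulVec x with hy
  have h1 : ∑ i, ∑ j, x i * adjMat G i j * x j = ∑ i, hA.eigenvalues i * y i ^ 2 := by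
    have : ∑ i, ∑ j, x i * adjMat G i j * x j = x ⬝ᵥ (adjMat G).mulVec x := by
      simp [dotProduct, Matrix.mulVec, Finset.mul_sum, mul_assoc]
    rw [this]
    conv_lhs => rw [hspec]
    rw [← Matrix.mulVec_mulVec, ← Matrix.mulVec_mulVec, Matrix.dotProduct_mulVec,
      ← Matrix.mulVec_transpose, ← hy]
    simp [dotProduct, Matrix.mulVec_diagonal]
    refine Finset.sum_congr rfl fun i _ => by ring
  have h2 : ∑ i, x i ^ 2 = ∑ i, y i ^ 2 := by
    have e1 : ∑ i, y i ^ 2 = y ⬝ᵥ y := by simp [dotProduct, sq]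
    have e2 : ∑ i, x i ^ 2 = x ⬝ᵥ x := by simp [dotProduct, sq]
    rw [e1, e2]
    conv_rhs => rw [hy, Matrix.dotProduct_mulVec, ← Matrix.mulVec_transpose, Matrix.mulVec_mulVec]
    simp [hUU]
  rw [h1, h2, Finset.mul_sum]
  exact Finset.sum_le_sum fun i _ => mul_le_mul_of_nonneg_right (hle i) (sq_nonneg _)

theorem kiteG_rho (t n : ℕ) (ht : 3 ≤ t) (hn : t + 1 ≤ n) :
    (t : ℝ) - 2 < specRad (kiteG t n) := by
  have htr : (3 : ℝ) ≤ t := by exact_mod_cast ht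
  set ε : ℝ := 1 / ((t : ℝ) - 2) with hε
  have hε0 : 0 < ε := by apply one_div_pos.2; linarith
  have hεt : ((t : ℝ) - 2) * ε = 1 := by rw [hε]; field_simp; exact div_self (by linarith)
  let w : Fin n := ⟨t - 1, by omega⟩
  let z : Fin n := ⟨t - 2, by omega⟩
  let p : Fin n → ℝ := fun i => if i.val < t - 1 then 1 else 0
  let ew : Fin n → ℝ := fun i => if i = w then 1 else 0
  let ez : Fin n → ℝ := fun i => if i = z then 1 else 0
  let x : Fin n → ℝ := fun i => p i + ε * ew i
  have hp0 : ∀ i, 0 ≤ p i := fun i => by simp only [p]; split_ifs <;> norm_num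
  have hw0 : ∀ i, 0 ≤ ew i := fun i => by simp only [ew]; split_ifs <;> norm_num
  have hx0 : ∀ i, 0 ≤ x i := fun i => add_nonneg (hp0 i) (mul_nonneg hε0.le (hw0 i))
  have hpp : ∀ i, p i * p i = p i := fun i => by simp only [p]; split_ifs <;> norm_num
  have hww : ∀ i, ew i * ew i = ew i := fun i => by simp only [ew]; split_ifs <;> norm_num
  have hpw : ∀ i, p i * ew i = 0 := fun i => by
    simp only [p, ew]
    split_ifs with h1 h2 <;> norm_num
    subst h2; simp [w] at h1
  have hsp : ∑ i, p i = (t : ℝ) - 1 := by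
    have : (Finset.univ.filter (fun i : Fin n => i.val < t - 1)).card = t - 1 := by
      rw [Fin.card_filter_val_lt]; omega
    simp only [p, Finset.sum_boole, this]
    rw [Nat.cast_sub (by omega)]; simp
  have hsw : ∑ i, ew i = 1 := by simp [ew]
  have hsq : ∑ i, x i ^ 2 = (t : ℝ) - 1 + ε ^ 2 := by
    have : ∀ i, x i ^ 2 = p i + ε ^ 2 * ew i := fun i => by
      simp only [x]; linear_combination hpp i + ε ^ 2 * hww i + 2 * ε * hpw i
    simp only [this, Finset.sum_add_distrib, ← Finset.mul_sum, hsp, hsw, mul_one]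
  have hxp : ∀ i, x i * p i = p i := fun i => by
    simp only [x]; linear_combination hpp i + ε * hpw i
  have hA : ∀ i j, p i * p j - (if i = j then p i else 0) + ew i * ez j + ez i * ew j
      ≤ adjMat (kiteG t n) i j := by
    intro i j
    have hval : adjMat (kiteG t n) i j = 1 ∧ (kiteG t n).Adj i j ∨
        adjMat (kiteG t n) i j = 0 ∧ ¬ (kiteG t n).Adj i j := by
      by_cases h : (kiteG t n).Adj i j
      · left; simp [adjMat, h]
      · right; simp [adjMat, h]
    simp only [p, ew, ez, Fin.ext_iff, w, z]
    rcases hval with ⟨h1, h2⟩ | ⟨h1, h2⟩ <;> rw [h1] <;> clear h1 <;>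
      simp only [kiteG] at h2 <;> split_ifs <;> first | omega | norm_num
  have hlow : ((t : ℝ) - 1) ^ 2 - (t - 1) + 2 * ε ≤
      ∑ i, ∑ j, x i * adjMat (kiteG t n) i j * x j := by
    have e : ∑ i, ∑ j, x i * (p i * p j - (if i = j then p i else 0) + ew i * ez j + ez i * ew j)
        * x j = ((t : ℝ) - 1) ^ 2 - (t - 1) + 2 * ε := by
      have hxw : ∑ i, x i * ew i = ε := by
        have : ∀ i, x i * ew i = ε * ew i := fun i => by
          simp only [x]; linear_combination ε * hww i + hpw i
        simp only [this, ← Finset.mul_sum, hsw, mul_one]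
      have hxz : ∑ i, x i * ez i = 1 := by
        simp only [ez, mul_ite, mul_one, mul_zero, Finset.sum_ite_eq', Finset.mem_univ, if_true]
        simp only [x, p, ew, z, w, Fin.ext_iff]
        rw [if_pos (by omega), if_neg (by omega)]; simp
      have hd : ∀ i, ∑ j, x i * (if i = j then p i else 0) * x j = p i := fun i => by
        simp [hxp]; rw [mul_comm, hxp]
      have e1 : ∑ i, ∑ j, x i * (p i * p j - (if i = j then p i else 0) + ew i * ez j + ez i * ew j)
        * x j = ∑ i, ∑ j, (x i * p i) * (x j * p j) - ∑ i, ∑ j, x i * (if i = j then p i else 0) * x j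
          + ∑ i, ∑ j, (x i * ew i) * (x j * ez j) + ∑ i, ∑ j, (x i * ez i) * (x j * ew j) := by
        simp only [← Finset.sum_add_distrib, ← Finset.sum_sub_distrib]
        refine Finset.sum_congr rfl fun i _ => Finset.sum_congr rfl fun j _ => by ring
      rw [e1]
      simp only [hd, ← Finset.sum_mul_sum, hxw, hxz, hxp, hsp]
      ring
    rw [← e]
    refine Finset.sum_le_sum fun i _ => Finset.sum_le_sum fun j _ => ?_
    exact mul_le_mul_of_nonneg_right (mul_le_mul_of_nonneg_left (hA i j) (hx0 i)) (hx0 j)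
  have hR := rayleigh_le (kiteG t n) x
  rw [hsq] at hR
  by_contra hcon
  push Not at hcon
  have h3 := mul_le_mul_of_nonneg_right hcon (show 0 ≤ (t : ℝ) - 1 + ε ^ 2 by nlinarith)
  have h4 : ((t : ℝ) - 2) * ((t : ℝ) - 1 + ε ^ 2) = (t - 2) * (t - 1) + ε := by
    linear_combination ε * hεt
  nlinarith

/-- Lemma 5.2: ρ > t − 2 and the maximal-entry vertex has degree t − 1. -/
theorem rho_gt_and_max_degree (t n : ℕ) (ht : 3 ≤ t) (hn : t + 1 ≤ n)
    (G : SimpleGraph (Fin n)) (hconn : G.Connected)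
    (hfree : ¬ MinorOf (completeBipartiteGraph (Fin 1) (Fin t)) G)
    (hmax : ∀ G' : SimpleGraph (Fin n), G'.Connected →
      ¬ MinorOf (completeBipartiteGraph (Fin 1) (Fin t)) G' → specRad G' ≤ specRad G)
    (X : Fin n → ℝ) (hX : ∀ v, 0 < X v)
    (heig : (adjMat G).mulVec X = specRad G • X)
    (u : Fin n) (hu : ∀ v, X v ≤ X u) :
    (t : ℝ) - 2 < specRad G ∧ deg G u = t - 1 := by
  have hrho : (t : ℝ) - 2 < specRad G :=
    (kiteG_rho t n ht hn).trans_le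
      (hmax _ (kiteG_connected t n (by omega)) (kiteG_free t n ht))
  refine ⟨hrho, le_antisymm ?_ ?_⟩
  · by_contra hlt
    apply hfree
    have hcard : t ≤ (G.neighborSet u).ncard := by unfold deg at hlt; omega
    obtain ⟨s, hs, hsc⟩ := Set.exists_subset_card_eq hcard
    have hsf : s.Finite := Set.toFinite _
    haveI := hsf.fintype
    have hc : Fintype.card s = t := by rw [← hsc, Set.ncard_eq_toFinset_card', Set.toFinset_card]
    let e : Fin t ≃ s := (Fintype.equivFinOfCardEq hc).symm
    have hadj : ∀ i, G.Adj u (e i).1 := fun i => hs (e i).2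
    refine ⟨Sum.elim (fun _ => {u}) (fun i => {(e i).1}), ?_, ?_, ?_⟩
    · rintro (a | a) <;> simp only [Sum.elim_inl, Sum.elim_inr] <;>
        exact ⟨Preconnected.of_subsingleton⟩
    · rintro (a | a) (b | b) hab
      · exact absurd (congrArg Sum.inl (Subsingleton.elim a b)) hab
      · simpa using (hadj b).ne
      · simpa using (hadj a).ne'
      · simp only [Sum.elim_inr, Set.disjoint_singleton]
        intro h
        exact hab (congrArg Sum.inr (e.injective (Subtype.ext h)))
    · rintro (a | a) (b | b) hab
      · simp at hab
      · exact ⟨u, rfl, _, rfl, hadj b⟩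
      · exact ⟨_, rfl, u, rfl, (hadj a).symm⟩
      · simp at hab
  · have h := congrFun heig u
    classical
    have h1 : (adjMat G).mulVec X u ≤ deg G u * X u := by
      have hd : (deg G u : ℝ) = ∑ j, adjMat G u j := by
        simp only [adjMat, adjMatrix_apply, Finset.sum_boole, deg]
        rw [Set.ncard_eq_toFinset_card']
        congr 2
        ext j
        simp
      rw [hd, Finset.sum_mul]
      simp only [Matrix.mulVec, dotProduct]
      refine Finset.sum_le_sum fun j _ => mul_le_mul_of_nonneg_left (hu j) ?_
      simp only [adjMat, adjMatrix_apply]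
      split_ifs <;> norm_num
    rw [h] at h1
    simp only [Pi.smul_apply, smul_eq_mul] at h1
    have h2 := le_of_mul_le_mul_right h1 (hX u)
    have h3 : (t : ℝ) < (deg G u : ℝ) + 2 := by linarith
    have h4 : t < deg G u + 2 := by exact_mod_cast h3
    omega
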